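/- arXiv:1811.09981 — 6 statements merged into one kernel-verified Lean document; each statement's English description precedes it below -/
import Mathlib

section
/- Let A be a d-dimensional (0,1)-matrix of order n (d, n ≥ 1). Then the maximum weight of a polyplex contained in A is equal to the minimum weight of a hyperplane cover of A. -/
open Finset

/-- A d-dimensional matrix of order n is a (0,1)-matrix if all entries are 0 or 1. -/
def IsZeroOne {d n : ℕ} (A : (Fin d → Fin n) → ℝ) : Prop :=
  ∀ α, A α = 0 ∨ A α = 1

/-- A polyplex: nonnegative entries, each hyperplane sum at most 1. -/
def IsPolyplex {d n : ℕ} (K : (Fin d → Fin n) → ℝ) : Prop :=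
  (∀ α, 0 ≤ K α) ∧
  ∀ (i : Fin d) (j : Fin n),
    (∑ α : Fin d → Fin n, if α i = j then K α else 0) ≤ 1

/-- The weight of a polyplex: the sum of all its entries. -/
def plexWeight {d n : ℕ} (K : (Fin d → Fin n) → ℝ) : ℝ := ∑ α, K α

/-- K is contained in A: supp(K) ⊆ supp(A). -/
def ContainedIn {d n : ℕ} (K A : (Fin d → Fin n) → ℝ) : Prop :=
  ∀ α, K α ≠ 0 → A α ≠ 0

/-- The set of weights of polyplexes contained in A. -/
def polyplexWeights {d n : ℕ} (A : (Fin d → Fin n) → ℝ) : Set ℝ :=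
  {W | ∃ K, IsPolyplex K ∧ ContainedIn K A ∧ plexWeight K = W}

/-- A contains a polydiagonal: a polyplex of weight n. -/
def HasPolydiagonal {d n : ℕ} (A : (Fin d → Fin n) → ℝ) : Prop :=
  ∃ K, IsPolyplex K ∧ ContainedIn K A ∧ plexWeight K = (n : ℝ)

/-- A is extremal: no polydiagonal, but changing any zero entry to 1 creates one. -/
def IsExtremal {d n : ℕ} (A : (Fin d → Fin n) → ℝ) : Prop :=
  ¬ HasPolydiagonal A ∧
  ∀ α, A α = 0 → HasPolydiagonal (Function.update A α (1 : ℝ))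

/-- A hyperplane cover of A: nonnegative weights on hyperplanes covering supp(A). -/
def IsCover {d n : ℕ} (A : (Fin d → Fin n) → ℝ) (Λ : Fin d → Fin n → ℝ) : Prop :=
  (∀ i j, 0 ≤ Λ i j) ∧ ∀ α, A α ≠ 0 → 1 ≤ ∑ i, Λ i (α i)

/-- The weight of a hyperplane cover. -/
def coverWeight {d n : ℕ} (Λ : Fin d → Fin n → ℝ) : ℝ := ∑ i, ∑ j, Λ i j

/-- The set of weights of hyperplane covers of A. -/
def coverWeights {d n : ℕ} (A : (Fin d → Fin n) → ℝ) : Set ℝ :=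
  {W | ∃ Λ : Fin d → Fin n → ℝ, IsCover A Λ ∧ coverWeight Λ = W}

/-- Λ is an optimal hyperplane cover of A. -/
def IsOptimalCover {d n : ℕ} (A : (Fin d → Fin n) → ℝ) (Λ : Fin d → Fin n → ℝ) : Prop :=
  IsCover A Λ ∧ ∀ Λ' : Fin d → Fin n → ℝ, IsCover A Λ' → coverWeight Λ ≤ coverWeight Λ'

/-- K is an optimal polyplex contained in A. -/
def IsOptimalPolyplex {d n : ℕ} (A K : (Fin d → Fin n) → ℝ) : Prop :=
  IsPolyplex K ∧ ContainedIn K A ∧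
  ∀ K' : (Fin d → Fin n) → ℝ, IsPolyplex K' → ContainedIn K' A → plexWeight K' ≤ plexWeight K

/-- A(Λ): the (0,1)-matrix of indices covered with weight at least 1 by Λ. -/
noncomputable def matOf {d n : ℕ} (Λ : Fin d → Fin n → ℝ) : (Fin d → Fin n) → ℝ :=
  fun α => if 1 ≤ ∑ i, Λ i (α i) then (1 : ℝ) else 0

/-- A has deficiency δ: the maximum weight of a polyplex contained in A is n − δ. -/
def HasDeficiency {d n : ℕ} (A : (Fin d → Fin n) → ℝ) (δ : ℝ) : Prop :=
  IsGreatest (polyplexWeights A) ((n : ℝ) - δ)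

/-- If `a + t * s < F` for all `t > 0`, then `a ≤ F` and `s ≤ 0`. -/
lemma le_and_nonpos_of_forall_add_mul_lt {a s F : ℝ} (h : ∀ t > 0, a + t * s < F) :
    a ≤ F ∧ s ≤ 0 := by
  have hs : s ≤ 0 := by
    by_contra! hs
    have h1 := h ((|F - a| + 1) / s) (by positivity)
    rw [div_mul_cancel₀ _ hs.ne'] at h1
    linarith [le_abs_self (F - a)]
  refine ⟨?_, hs⟩
  by_contra! ha
  rcases hs.eq_or_lt with rfl | hs
  · linarith [h 1 one_pos]
  · have h1 := h ((a - F) / (-s)) (div_pos (by linarith) (by linarith))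
    have h2 : (a - F) / (-s) * s = F - a := by
      rw [div_neg, neg_mul, div_mul_cancel₀ _ hs.ne, neg_sub]
    linarith

/-- Strong duality for linear programs with a strictly positive right-hand side: an upper bound
`M` for the primal program is witnessed by a dual feasible vector. -/
theorem exists_dual_of_primal_bound {ι κ : Type*} [Fintype ι] [Fintype κ]
    (B : ι → κ → ℝ) (b : ι → ℝ) (c : κ → ℝ) (M : ℝ) (hb : ∀ i, 0 < b i)
    (hM : ∀ x : κ → ℝ, (∀ k, 0 ≤ x k) → (∀ i, ∑ k, B i k * x k ≤ b i) → ∑ k, c k * x k ≤ M) :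
    ∃ l : ι → ℝ, (∀ i, 0 ≤ l i) ∧ (∀ k, c k ≤ ∑ i, l i * B i k) ∧ ∑ i, l i * b i ≤ M := by
  classical
  let C : Set ((ι → ℝ) × ℝ) :=
    {p | ∃ x : κ → ℝ, (∀ k, 0 ≤ x k) ∧ (∀ i, ∑ k, B i k * x k < p.1 i) ∧ p.2 < ∑ k, c k * x k}
  have hconv : Convex ℝ C := by
    rintro p ⟨x, hx, hxB, hxc⟩ q ⟨y, hy, hyB, hyc⟩ s t hs ht hst
    have key (v : κ → ℝ) : ∑ k, v k * (s * x k + t * y k) =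
        s * ∑ k, v k * x k + t * ∑ k, v k * y k := by
      rw [mul_sum, mul_sum, ← sum_add_distrib]
      exact sum_congr rfl fun k _ => by ring
    have mix {u u' w w' : ℝ} (h : u < u') (h' : w < w') : s * u + t * w < s * u' + t * w' := by
      rcases hs.eq_or_lt with rfl | hs
      · have : t = 1 := by linarith
        simpa [this] using h'
      · exact add_lt_add_of_lt_of_le (mul_lt_mul_of_pos_left h hs)
          (mul_le_mul_of_nonneg_left h'.le ht)
    refine ⟨fun k => s * x k + t * y k,
      fun k => add_nonneg (mul_nonneg hs (hx k)) (mul_nonneg ht (hy k)), fun i => ?_, ?_⟩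
    · rw [key]
      exact mix (hxB i) (hyB i)
    · rw [key]
      exact mix hxc hyc
  have hopen : IsOpen C := by
    have hC : C = ⋃ x ∈ {x : κ → ℝ | ∀ k, 0 ≤ x k},
        ({p | ∀ i, ∑ k, B i k * x k < p.1 i} ∩ {p | p.2 < ∑ k, c k * x k}) := by
      ext p
      simp [C, and_left_comm]
    rw [hC]
    refine isOpen_biUnion fun x _ => IsOpen.inter ?_ (isOpen_lt (by fun_prop) (by fun_prop))
    rw [Set.ofPred_forall]
    exact isOpen_iInter_of_finite fun i => isOpen_lt (by fun_prop) (by fun_prop)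
  have hnot : (b, M) ∉ C := by
    rintro ⟨x, hx, hxB, hxc⟩
    exact (hM x hx fun i => (hxB i).le).not_gt hxc
  obtain ⟨f, hf⟩ := geometric_hahn_banach_open_point hconv hopen hnot
  set μ := f (0, 1) with hμ
  set g : ι → ℝ := fun i => f (Pi.single i 1, 0) with hg
  have hrep (y : ι → ℝ) (w : ℝ) : f (y, w) = ∑ i, g i * y i + μ * w := by
    have h1 : (y, w) = ∑ i, y i • ((Pi.single i 1, 0) : (ι → ℝ) × ℝ) + w • (0, 1) := by
      refine Prod.ext ?_ ?_
      · ext j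
        simp [Prod.fst_sum, Pi.single_apply]
      · simp [Prod.snd_sum]
    rw [h1, map_add, map_sum]
    simp only [map_smul, smul_eq_mul, hμ, hg, mul_comm]
  have hsep (x : κ → ℝ) (hx : ∀ k, 0 ≤ x k) (y : ι → ℝ) (w : ℝ)
      (hy : ∀ i, ∑ k, B i k * x k < y i) (hw : w < ∑ k, c k * x k) :
      ∑ i, g i * y i + μ * w < ∑ i, g i * b i + μ * M := by
    rw [← hrep, ← hrep]
    exact hf _ ⟨x, hx, hy, hw⟩
  have hM0 : 0 ≤ M := by simpa using hM 0 (by simp) (by simpa using fun i => (hb i).le)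
  have hμpos : 0 < μ := by
    have := hsep 0 (by simp) b (-1) (by simpa using hb) (by simp)
    by_contra! h
    nlinarith
  have hclosed (x : κ → ℝ) (hx : ∀ k, 0 ≤ x k) (y : ι → ℝ) (hy : ∀ i, ∑ k, B i k * x k ≤ y i) :
      ∑ i, g i * y i + μ * ∑ k, c k * x k ≤ ∑ i, g i * b i + μ * M := by
    refine (le_and_nonpos_of_forall_add_mul_lt (s := ∑ i, g i - μ) fun t ht => ?_).1
    convert hsep x hx (fun i => y i + t) (∑ k, c k * x k - t)
      (fun i => by linarith [hy i]) (by linarith) using 1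
    simp only [mul_add, sum_add_distrib, ← sum_mul]
    ring
  have nonpos {a s F : ℝ} (h : ∀ t > 0, a + t * s ≤ F) : s ≤ 0 :=
    (le_and_nonpos_of_forall_add_mul_lt (a := a) (F := F + 1) fun t ht => by linarith [h t ht]).2
  refine ⟨fun i => -g i / μ, fun i => ?_, fun k => ?_, ?_⟩
  · refine div_nonneg (neg_nonneg.2 ?_) hμpos.le
    refine nonpos (a := 0) (F := ∑ i, g i * b i + μ * M) fun t ht => ?_
    have := hclosed 0 (by simp) (Pi.single i t) fun j => by
      simp only [Pi.zero_apply, mul_zero, sum_const_zero, Pi.single_apply]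
      split_ifs
      exacts [ht.le, le_rfl]
    simpa [Pi.single_apply, mul_comm] using this
  · have h : ∑ i, g i * B i k + μ * c k ≤ 0 := by
      refine nonpos (a := 0) (F := ∑ i, g i * b i + μ * M) fun t ht => ?_
      have := hclosed (Pi.single k t) (fun j => by
        simp only [Pi.single_apply]
        split_ifs
        exacts [ht.le, le_rfl]) (fun i => B i k * t) (fun i => by simp [Pi.single_apply])
      simp only [Pi.single_apply, mul_ite, mul_zero, sum_ite_eq', mem_univ, if_true,
        ← mul_assoc, ← sum_mul] at this
      linarith
    simp only [div_mul_eq_mul_div, ← sum_div, neg_mul, sum_neg_distrib]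
    rw [le_div_iff₀ hμpos]
    linarith
  · have h := hclosed 0 (by simp) 0 (by simp)
    simp only [Pi.zero_apply, mul_zero, sum_const_zero, add_zero] at h
    simp only [div_mul_eq_mul_div, ← sum_div, neg_mul, sum_neg_distrib]
    rw [div_le_iff₀ hμpos]
    linarith

/-- Weak duality: the weight of a polyplex is at most the weight of a hyperplane cover. -/
lemma plexWeight_le_coverWeight {d n : ℕ} {A K : (Fin d → Fin n) → ℝ} {Λ : Fin d → Fin n → ℝ}
    (hK : IsPolyplex K) (hKA : ContainedIn K A) (hΛ : IsCover A Λ) :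
    plexWeight K ≤ coverWeight Λ := by
  calc plexWeight K ≤ ∑ α, ∑ i, Λ i (α i) * K α := by
        refine sum_le_sum fun α _ => ?_
        rw [← sum_mul]
        by_cases h : K α = 0
        · simp [h]
        · exact le_mul_of_one_le_left (hK.1 α) (hΛ.2 α (hKA α h))
    _ = ∑ i, ∑ j, Λ i j * ∑ α, if α i = j then K α else 0 := by
        rw [sum_comm]
        refine sum_congr rfl fun i _ => ?_
        simp_rw [mul_sum]
        rw [sum_comm]
        exact sum_congr rfl fun α _ => by simp
    _ ≤ coverWeight Λ := sum_le_sum fun i _ => sum_le_sum fun j _ =>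
        mul_le_of_le_one_right (hΛ.1 i j) (hK.2 i j)

/-- In positive dimension, some polyplex contained in `A` has maximum weight. -/
lemma exists_isOptimalPolyplex {d n : ℕ} (hd : 1 ≤ d) (A : (Fin d → Fin n) → ℝ) :
    ∃ K, IsOptimalPolyplex A K := by
  have hcont (i : Fin d) (j : Fin n) :
      Continuous fun K : (Fin d → Fin n) → ℝ => ∑ α, if α i = j then K α else 0 :=
    continuous_finsetSum _ fun α _ => by split_ifs <;> fun_prop
  have hclosed : IsClosed {K : (Fin d → Fin n) → ℝ | IsPolyplex K ∧ ContainedIn K A} := by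
    simp only [IsPolyplex, ContainedIn, Set.ofPred_and, Set.ofPred_forall]
    refine ((isClosed_iInter fun α => isClosed_le (by fun_prop) (by fun_prop)).inter
      (isClosed_iInter fun i => isClosed_iInter fun j =>
        isClosed_le (hcont i j) continuous_const)).inter (isClosed_iInter fun α => ?_)
    by_cases h : A α = 0
    · simpa [h] using isClosed_eq (continuous_apply α) continuous_const
    · simp [h]
  have hsub : {K : (Fin d → Fin n) → ℝ | IsPolyplex K ∧ ContainedIn K A} ⊆ Set.Icc 0 1 := by
    rintro K ⟨hK, -⟩
    refine ⟨hK.1, fun α => ?_⟩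
    refine le_trans ?_ (hK.2 ⟨0, hd⟩ (α ⟨0, hd⟩))
    refine le_trans (by simp) (single_le_sum (fun β _ => ?_) (mem_univ α))
    split_ifs
    exacts [hK.1 β, le_rfl]
  obtain ⟨K, hK, hmax⟩ := (isCompact_Icc.of_isClosed_subset hclosed hsub).exists_isMaxOn
    ⟨0, ⟨fun _ => le_rfl, fun i j => by simp⟩, fun α h => (h rfl).elim⟩
    (f := plexWeight) (by unfold plexWeight; fun_prop)
  exact ⟨K, hK.1, hK.2, fun K' h1 h2 => hmax ⟨h1, h2⟩⟩

/-- The maximum weight of a polyplex contained in A equals the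
minimum weight of a hyperplane cover of A. -/
theorem stmt_0 (d n : ℕ) (hd : 1 ≤ d) (hn : 1 ≤ n)
    (A : (Fin d → Fin n) → ℝ) (hA : IsZeroOne A) :
    ∃ W : ℝ, IsGreatest (polyplexWeights A) W ∧ IsLeast (coverWeights A) W := by
  obtain ⟨K, hK, hKA, hmax⟩ := exists_isOptimalPolyplex hd A
  obtain ⟨l, hl, hcov, hle⟩ := exists_dual_of_primal_bound
    (fun (p : Fin d × Fin n) (α : Fin d → Fin n) => if α p.1 = p.2 then (1 : ℝ) else 0)
    (fun _ => 1) (fun α => if A α ≠ 0 then 1 else 0) (plexWeight K) (fun _ => one_pos) (by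
      intro x hx hxB
      refine hmax (fun α => (if A α ≠ 0 then 1 else 0) * x α) ⟨fun α => ?_, fun i j => ?_⟩
        fun α h hα => h (by simp [hα])
      · exact mul_nonneg (by split_ifs <;> norm_num) (hx α)
      · refine le_trans (sum_le_sum fun α _ => ?_) (hxB (i, j))
        have := hx α
        dsimp only
        split_ifs <;> simp [this])
  have hΛ : IsCover A fun i j => l (i, j) := by
    refine ⟨fun i j => hl (i, j), fun α hα => ?_⟩
    simpa [hα, Fintype.sum_prod_type] using hcov α
  have hweight : coverWeight (fun i j => l (i, j)) ≤ plexWeight K := by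
    simpa [coverWeight, Fintype.sum_prod_type] using hle
  refine ⟨plexWeight K, ⟨⟨K, hK, hKA, rfl⟩, ?_⟩,
    ⟨_, hΛ, hweight.antisymm (plexWeight_le_coverWeight hK hKA hΛ)⟩, ?_⟩
  · rintro _ ⟨K', h1, h2, rfl⟩
    exact hmax K' h1 h2
  · rintro _ ⟨Λ, hΛ', rfl⟩
    exact plexWeight_le_coverWeight hK hKA hΛ'
end

section
/- Let A be an extremal d-dimensional (0,1)-matrix of order n and let Λ be an optimal hyperplane cover of A. Then each row of Λ contains at least one zero entry: for every direction i ∈ {1,…,d} there exists j ∈ {1,…,n} with λ_{i,j} = 0. -/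
open Finset

/-- A positive finite family stays nonnegative under a small perturbation. -/
theorem exists_pos_forall_nonneg_add_mul {ι : Type*} [Finite ι] (a y : ι → ℝ)
    (ha : ∀ i, 0 < a i) : ∃ ε : ℝ, 0 < ε ∧ ∀ i, 0 ≤ a i + ε * y i := by
  have h : ∀ᶠ ε : ℝ in nhdsWithin 0 (Set.Ioi 0), ∀ i, 0 < a i + ε * y i := by
    refine Filter.eventually_all.2 fun i => nhdsWithin_le_nhds ?_
    have hc : Continuous fun ε : ℝ => a i + ε * y i := by fun_prop
    exact (hc.tendsto 0).eventually (lt_mem_nhds (by simpa using ha i))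
  obtain ⟨ε, h1, h2⟩ := (h.and self_mem_nhdsWithin).exists
  exact ⟨ε, h2, fun i => (h1 i).le⟩

/-- The linear map sending a matrix to its family of hyperplane sums. -/
noncomputable def hyperplaneSums (d n : ℕ) :
    ((Fin d → Fin n) → ℝ) →ₗ[ℝ] (Fin d × Fin n → ℝ) where
  toFun k p := ∑ α : Fin d → Fin n, if α p.1 = p.2 then k α else 0
  map_add' k l := by
    ext p
    simp only [Pi.add_apply, ← Finset.sum_add_distrib]
    exact Finset.sum_congr rfl fun α _ => by split_ifs <;> simp
  map_smul' c k := by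
    ext p
    simp only [Pi.smul_apply, smul_eq_mul, RingHom.id_apply, Finset.mul_sum, mul_ite, mul_zero]

theorem hyperplaneSums_single {d n : ℕ} (α : Fin d → Fin n) (p : Fin d × Fin n) :
    hyperplaneSums d n (Pi.single α 1) p = if α p.1 = p.2 then 1 else 0 := by
  simp only [hyperplaneSums, LinearMap.coe_mk, AddHom.coe_mk]
  rw [Finset.sum_eq_single α]
  · simp
  · intro β _ hβ
    simp [hβ]
  · simp

/-- By convex separation, a matrix without a polydiagonal has a hyperplane cover of weight
less than its order. -/
theorem exists_isCover_coverWeight_lt {d n : ℕ} (hd : 0 < d) (hn : 0 < n)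
    (A : (Fin d → Fin n) → ℝ) (hA : ¬ HasPolydiagonal A) :
    ∃ Λ : Fin d → Fin n → ℝ, IsCover A Λ ∧ coverWeight Λ < n := by
  have hd' : (0 : ℝ) < d := by exact_mod_cast hd
  have hn' : (0 : ℝ) < n := by exact_mod_cast hn
  set S : Set ((Fin d → Fin n) → ℝ) :=
    stdSimplex ℝ (Fin d → Fin n) ∩ {k | ∀ α, A α = 0 → k α = 0} with hS
  have hScomp : IsCompact S := by
    refine (isCompact_stdSimplex ℝ _).inter_right ?_
    simp only [Set.ofPred_forall]
    exact isClosed_iInter fun α => isClosed_iInter fun _ =>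
      isClosed_eq (continuous_apply α) continuous_const
  have hSconv : Convex ℝ S := by
    refine (convex_stdSimplex ℝ _).inter ?_
    intro k hk l hl a b _ _ _ α hα
    simp [hk α hα, hl α hα]
  have hcont : Continuous (hyperplaneSums d n) := LinearMap.continuous_of_finiteDimensional _
  have hnot : (fun _ => (n : ℝ)⁻¹ : Fin d × Fin n → ℝ) ∉ hyperplaneSums d n '' S := by
    rintro ⟨k, ⟨⟨hk0, hk1⟩, hkA⟩, hk⟩
    refine hA ⟨(n : ℝ) • k, ⟨fun α => ?_, fun i j => ?_⟩, fun α hα hAα => hα ?_, ?_⟩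
    · exact mul_nonneg hn'.le (hk0 α)
    · have h := congrFun (map_smul (hyperplaneSums d n) (n : ℝ) k) (i, j)
      rw [hk] at h
      simp only [Pi.smul_apply, smul_eq_mul, mul_inv_cancel₀ hn'.ne'] at h
      exact h.le
    · simp [hkA α hAα]
    · simp [plexWeight, ← Finset.mul_sum, hk1]
  obtain ⟨f, u, hfu, hf⟩ := geometric_hahn_banach_point_closed
    (hSconv.linear_image (hyperplaneSums d n)) (hScomp.image hcont).isClosed hnot
  set g : Fin d × Fin n → ℝ := fun p => f fun q => if p = q then 1 else 0
  have hfg (x : Fin d × Fin n → ℝ) : f x = ∑ i, ∑ j, x (i, j) * g (i, j) := by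
    have h := LinearMap.pi_apply_eq_sum_univ (f : (Fin d × Fin n → ℝ) →ₗ[ℝ] ℝ) x
    rw [Fintype.sum_prod_type] at h
    exact h
  have hsum : ∑ i, ∑ j, g (i, j) < n * u := by
    rw [hfg] at hfu
    simp only [← Finset.mul_sum] at hfu
    rwa [inv_mul_lt_iff₀ hn'] at hfu
  have hcov : ∀ α, A α ≠ 0 → u < ∑ i, g (i, α i) := by
    intro α hα
    have hmem : (Pi.single α 1 : (Fin d → Fin n) → ℝ) ∈ S := by
      refine ⟨single_mem_stdSimplex ℝ α, fun β hβ => ?_⟩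
      have : β ≠ α := by rintro rfl; exact hα hβ
      simp [this]
    have h := hf _ ⟨_, hmem, rfl⟩
    rw [hfg] at h
    simpa [hyperplaneSums_single] using h
  obtain ⟨ε, hε, hnonneg⟩ := exists_pos_forall_nonneg_add_mul
    (fun _ : Fin d × Fin n => (d : ℝ)⁻¹) (fun p => g p - u / d) fun _ => inv_pos.2 hd'
  refine ⟨fun i j => (d : ℝ)⁻¹ + ε * (g (i, j) - u / d),
    ⟨fun i j => hnonneg (i, j), fun α hα => ?_⟩, ?_⟩
  · have h : ∑ i, ((d : ℝ)⁻¹ + ε * (g (i, α i) - u / d)) =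
        1 + ε * (∑ i, g (i, α i) - u) := by
      simp only [Finset.sum_add_distrib, ← Finset.mul_sum, Finset.sum_sub_distrib,
        Finset.sum_const, Finset.card_univ, Fintype.card_fin, nsmul_eq_mul]
      field_simp
    rw [h]
    nlinarith [hcov α hα]
  · have h : coverWeight (fun i j => (d : ℝ)⁻¹ + ε * (g (i, j) - u / d)) =
        n + ε * (∑ i, ∑ j, g (i, j) - n * u) := by
      simp only [coverWeight, Finset.sum_add_distrib, ← Finset.mul_sum, Finset.sum_sub_distrib,
        Finset.sum_const, Finset.card_univ, Fintype.card_fin, nsmul_eq_mul]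
      field_simp
    rw [h]
    nlinarith

/-- An optimal hyperplane cover of weight less than the order has a zero entry in each
row. -/
theorem IsOptimalCover.exists_eq_zero {d n : ℕ} {A : (Fin d → Fin n) → ℝ}
    {Λ : Fin d → Fin n → ℝ} (hΛ : IsOptimalCover A Λ) (hlt : coverWeight Λ < n) (i : Fin d) :
    ∃ j, Λ i j = 0 := by
  obtain ⟨⟨hnonneg, hcov⟩, hopt⟩ := hΛ
  by_contra! hne
  obtain ⟨t, ht, hrow⟩ := exists_pos_forall_nonneg_add_mul (Λ i) (fun j => Λ i j - 1)
    fun j => (hnonneg i j).lt_of_ne' (hne j)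
  have h := hopt (fun i' j => (1 + t) * Λ i' j - t * if i' = i then 1 else 0)
    ⟨fun i' j => ?_, fun α hα => ?_⟩
  · have hw : coverWeight (fun i' j => (1 + t) * Λ i' j - t * if i' = i then 1 else 0) =
        (1 + t) * coverWeight Λ - t * n := by
      simp [coverWeight, Finset.sum_sub_distrib, ← Finset.mul_sum]
      ring
    rw [hw] at h
    nlinarith
  · by_cases hi : i' = i
    · subst hi
      simp only [if_true]
      linarith [hrow j]
    · simp only [hi, if_false, mul_zero, sub_zero]
      exact mul_nonneg (by linarith) (hnonneg i' j)
  · simp only [Finset.sum_sub_distrib, ← Finset.mul_sum, Finset.sum_ite_eq', Finset.mem_univ,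
      if_true]
    nlinarith [hcov α hα]

/-- each row of an optimal hyperplane cover of an extremal matrix
contains a zero entry. -/
theorem stmt_5 (d n : ℕ) (A : (Fin d → Fin n) → ℝ) (hA : IsZeroOne A)
    (hE : IsExtremal A) (Λ : Fin d → Fin n → ℝ) (hΛ : IsOptimalCover A Λ) :
    ∀ i : Fin d, ∃ j : Fin n, Λ i j = 0 := by
  intro i
  have hn : 0 < n := by
    rcases Nat.eq_zero_or_pos n with rfl | hn
    · have : IsEmpty (Fin d → Fin 0) := ⟨fun α => (α i).elim0⟩
      exact absurd ⟨0, ⟨fun _ => le_rfl, fun _ j => j.elim0⟩, fun α => isEmptyElim α,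
        by simp [plexWeight]⟩ hE.1
    · exact hn
  obtain ⟨Λ', hcov, hlt⟩ := exists_isCover_coverWeight_lt i.pos hn A hE.1
  exact hΛ.exists_eq_zero ((hΛ.2 Λ' hcov).trans_lt hlt) i
end

section
/- Let A be an extremal d-dimensional (0,1)-matrix of order n with deficiency δ < 1 and let Λ be an optimal hyperplane cover of A. Then in each hyperplane Γ_{i,j} there exists an index α (i.e., an α with α_i = j) such that ∑_{l=1}^d λ_{l,α_l} = 1. -/
open Finset

/-- The sum of the entries of a matrix in the hyperplane `α i = j`. -/
def hyperplaneSum {d n : ℕ} (K : (Fin d → Fin n) → ℝ) (i : Fin d) (j : Fin n) : ℝ :=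
  ∑ α : Fin d → Fin n, if α i = j then K α else 0

theorem sum_hyperplaneSum {d n : ℕ} (K : (Fin d → Fin n) → ℝ) (i : Fin d) :
    ∑ j, hyperplaneSum K i j = plexWeight K := by
  unfold hyperplaneSum plexWeight
  rw [Finset.sum_comm]
  simp

theorem sum_mul_hyperplaneSum {d n : ℕ} (K : (Fin d → Fin n) → ℝ) (L : Fin d → Fin n → ℝ) :
    ∑ i, ∑ j, L i j * hyperplaneSum K i j = ∑ α, K α * ∑ i, L i (α i) := by
  unfold hyperplaneSum
  simp only [Finset.mul_sum]
  conv_rhs => rw [Finset.sum_comm]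
  refine Finset.sum_congr rfl fun i _ => ?_
  rw [Finset.sum_comm]
  refine Finset.sum_congr rfl fun α _ => ?_
  simp [mul_comm]

/-- Lagrange multipliers for maximizing a linear functional over a compact convex set subject to
finitely many linear inequalities. -/
theorem exists_lagrange_multipliers {ι E : Type*} [Fintype ι] [AddCommGroup E] [Module ℝ E]
    [TopologicalSpace E] {P : Set E} (hP : IsCompact P) (hconv : Convex ℝ P)
    (T : E →L[ℝ] (ι → ℝ)) (w : E →L[ℝ] ℝ) (b : ι → ℝ) (W : ℝ)
    (h : ∀ x ∈ P, T x ≤ b → w x < W) :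
    ∃ (l : ι → ℝ) (m : ℝ), 0 ≤ l ∧ 0 ≤ m ∧
      ∀ x ∈ P, m * w x - ∑ i, l i * T x i < m * W - ∑ i, l i * b i := by
  classical
  have hdisj : Disjoint (T.prod w '' P) (Set.Iic b ×ˢ Set.Ici W) := by
    rw [Set.disjoint_left]
    rintro _ ⟨x, hx, rfl⟩ ⟨h1, h2⟩
    exact absurd (h x hx h1) (not_lt.mpr h2)
  obtain ⟨f, u, v, hu, huv, hv⟩ := geometric_hahn_banach_compact_closed
    (hconv.linear_image (T.prod w).toLinearMap) (hP.image (T.prod w).continuous)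
    ((convex_Iic (𝕜 := ℝ) b).prod (convex_Ici (𝕜 := ℝ) W)) (isClosed_Iic.prod isClosed_Ici) hdisj
  have hf : ∀ y s, f (y, s) = s * f (0, 1) - ∑ i, (-f (Pi.single i 1, 0)) * y i := by
    intro y s
    have h1 : f (y, s) = f (y, 0) + s * f (0, 1) := by
      rw [← smul_eq_mul, ← map_smul, ← map_add]
      simp
    have h2 : f (y, 0) = ∑ i, y i * f (Pi.single i 1, 0) := by
      conv_lhs => rw [pi_eq_sum_univ' y]
      have := map_sum (f.comp (ContinuousLinearMap.inl ℝ (ι → ℝ) ℝ))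
        (fun i => y i • (Pi.single i 1 : ι → ℝ)) Finset.univ
      simp only [map_smul, smul_eq_mul] at this
      exact this
    rw [h1, h2, add_comm, sub_eq_add_neg, ← Finset.sum_neg_distrib]
    congr 1
    exact Finset.sum_congr rfl fun i _ => by ring
  have key : ∀ p : (ι → ℝ) × ℝ, p.1 ≤ 0 → 0 ≤ p.2 → 0 ≤ f p := by
    intro p h1 h2
    by_contra! hn
    obtain ⟨t, ht⟩ := exists_nat_gt ((f (b, W) - v) / (-f p))
    rw [div_lt_iff₀ (by linarith)] at ht
    have := hv ((b, W) + (t : ℝ) • p) (by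
      refine ⟨?_, ?_⟩
      · have : (t : ℝ) • p.1 ≤ 0 := smul_nonpos_of_nonneg_of_nonpos t.cast_nonneg h1
        simpa using this
      · have : 0 ≤ (t : ℝ) * p.2 := mul_nonneg t.cast_nonneg h2
        simpa using this)
    rw [map_add, map_smul, smul_eq_mul] at this
    linarith
  refine ⟨fun i => -f (Pi.single i 1, 0), f (0, 1), fun i => ?_, key _ le_rfl zero_le_one, ?_⟩
  · have := key (-(Pi.single i 1, 0)) (by simp) (by simp)
    rwa [map_neg] at this
  · intro x hx
    have h1 := hu _ ⟨x, hx, rfl⟩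
    have h2 := hv (b, W) ⟨le_refl b, le_refl W⟩
    have e : (T.prod w).toLinearMap x = (T x, w x) := rfl
    rw [e, hf] at h1
    rw [hf] at h2
    rw [mul_comm _ (w x), mul_comm _ W]
    linarith

/-- A bound on the weights of contained polyplexes is also the bound on the weight of some
hyperplane cover. -/
theorem exists_isCover_coverWeight_lt_s6 {d n : ℕ} {A : (Fin d → Fin n) → ℝ} (hA : IsZeroOne A)
    (i₀ : Fin d) {W : ℝ}
    (hW : ∀ K, IsPolyplex K → ContainedIn K A → plexWeight K < W) :
    ∃ L, IsCover A L ∧ coverWeight L < W := by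
  have hA0 : ∀ α, 0 ≤ A α := fun α => by rcases hA α with h | h <;> simp [h]
  let T : ((Fin d → Fin n) → ℝ) →L[ℝ] (Fin d × Fin n → ℝ) := LinearMap.toContinuousLinearMap
    { toFun := fun K p => hyperplaneSum K p.1 p.2
      map_add' := fun K K' => by
        ext p
        simp only [hyperplaneSum, Pi.add_apply, ← Finset.sum_add_distrib]
        exact Finset.sum_congr rfl fun α _ => by split_ifs <;> simp
      map_smul' := fun c K => by
        ext p
        simp [hyperplaneSum, Finset.mul_sum] }
  let w : ((Fin d → Fin n) → ℝ) →L[ℝ] ℝ := LinearMap.toContinuousLinearMap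
    { toFun := plexWeight
      map_add' := fun K K' => by simp [plexWeight, Finset.sum_add_distrib]
      map_smul' := fun c K => by simp [plexWeight, Finset.mul_sum] }
  obtain ⟨l, m, hl, hm, hlm⟩ := exists_lagrange_multipliers
    (isCompact_Icc (a := (0 : (Fin d → Fin n) → ℝ)) (b := A)) (convex_Icc 0 A) T w 1 W (by
      intro K hK hT
      refine hW K ⟨hK.1, fun i j => hT (i, j)⟩ fun α h0 hAα => h0 ?_
      exact le_antisymm (hAα ▸ hK.2 α) (hK.1 α))
  let c : (Fin d → Fin n) → ℝ := fun α => m - ∑ i, l (i, α i)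
  let K : (Fin d → Fin n) → ℝ := fun α => if 0 ≤ c α then A α else 0
  let D : (Fin d → Fin n) → ℝ := fun α => K α * c α
  have hD0 : ∀ α, 0 ≤ D α := fun α => by
    by_cases h : 0 ≤ c α
    · simpa [D, K, h] using mul_nonneg (hA0 α) h
    · simp [D, K, h]
  have hDc : ∀ α, A α ≠ 0 → c α ≤ D α := fun α hα => by
    have h1 : A α = 1 := (hA α).resolve_left hα
    by_cases h : 0 ≤ c α
    · simp [D, K, h, h1]
    · simpa [D, K, h] using (not_le.mp h).le
  have hKW := hlm K ⟨fun α => by dsimp [K]; split_ifs <;> simp [hA0],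
    fun α => by dsimp [K]; split_ifs <;> simp [hA0]⟩
  have hsum : m * plexWeight K - ∑ p : Fin d × Fin n, l p * hyperplaneSum K p.1 p.2
      = plexWeight D := by
    rw [Fintype.sum_prod_type, sum_mul_hyperplaneSum K fun i j => l (i, j)]
    simp only [plexWeight, D, c, Finset.mul_sum, mul_sub, Finset.sum_sub_distrib]
    congr 1
    exact Finset.sum_congr rfl fun α _ => mul_comm _ _
  change m * plexWeight K - ∑ p : Fin d × Fin n, l p * hyperplaneSum K p.1 p.2 < _ at hKW
  rw [hsum] at hKW
  simp only [Pi.one_apply, mul_one] at hKW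
  have hD : 0 ≤ plexWeight D := Finset.sum_nonneg fun α _ => hD0 α
  have hm' : 0 < m := by
    refine hm.lt_of_ne fun h0 => ?_
    have : 0 ≤ ∑ p, l p := Finset.sum_nonneg fun p _ => hl p
    rw [← h0] at hKW
    linarith
  have hDs : ∀ j, 0 ≤ hyperplaneSum D i₀ j := fun j =>
    Finset.sum_nonneg fun α _ => by split_ifs <;> simp [hD0]
  refine ⟨fun i j => (l (i, j) + if i = i₀ then hyperplaneSum D i₀ j else 0) / m,
    ⟨fun i j => div_nonneg (add_nonneg (hl _) ?_) hm, fun α hα => ?_⟩, ?_⟩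
  · split_ifs <;> simp [hDs]
  · rw [← Finset.sum_div, le_div_iff₀ hm', one_mul, Finset.sum_add_distrib]
    have h1 : D α ≤ hyperplaneSum D i₀ (α i₀) := by
      have := Finset.single_le_sum (f := fun β => if β i₀ = α i₀ then D β else 0)
        (fun β _ => by split_ifs <;> simp [hD0]) (Finset.mem_univ α)
      simpa [hyperplaneSum] using this
    have h2 := hDc α hα
    simp only [Finset.sum_ite_eq', Finset.mem_univ, if_true]
    dsimp only [c] at h2
    linarith
  · have : coverWeight (fun i j => (l (i, j) + if i = i₀ then hyperplaneSum D i₀ j else 0) / m)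
        = (∑ p, l p + plexWeight D) / m := by
      rw [coverWeight, Fintype.sum_prod_type, ← sum_hyperplaneSum D i₀]
      simp only [← Finset.sum_div, Finset.sum_add_distrib]
      congr 2
      rw [Finset.sum_comm]
      simp
    rw [this, div_lt_iff₀ hm']
    linarith

/-- Complementary slackness: a cover whose weight is at most that of a contained polyplex covers
the support of the polyplex exactly. -/
theorem sum_cover_eq_one_of_coverWeight_le {d n : ℕ} {A K : (Fin d → Fin n) → ℝ}
    {L : Fin d → Fin n → ℝ} (hK : IsPolyplex K) (hKA : ContainedIn K A) (hL : IsCover A L)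
    (hle : coverWeight L ≤ plexWeight K) {α : Fin d → Fin n} (hα : K α ≠ 0) :
    ∑ i, L i (α i) = 1 := by
  have h1 : ∀ β ∈ Finset.univ, K β ≤ K β * ∑ i, L i (β i) := fun β _ => by
    by_cases h : K β = 0
    · simp [h]
    · exact le_mul_of_one_le_right (hK.1 β) (hL.2 β (hKA β h))
  have h2 : ∑ β, K β * ∑ i, L i (β i) ≤ coverWeight L := by
    rw [← sum_mul_hyperplaneSum]
    exact Finset.sum_le_sum fun i _ => Finset.sum_le_sum fun j _ =>
      mul_le_of_le_one_right (hL.1 i j) (hK.2 i j)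
  have h3 := (Finset.sum_eq_sum_iff_of_le h1).mp
    (le_antisymm (Finset.sum_le_sum h1) (h2.trans hle)) α (Finset.mem_univ α)
  exact mul_left_cancel₀ hα (by rw [← h3, mul_one])

/-- A polyplex of weight greater than `n - 1` has a nonzero entry in each hyperplane. -/
theorem IsPolyplex.exists_ne_zero {d n : ℕ} {K : (Fin d → Fin n) → ℝ} (hK : IsPolyplex K)
    (hw : (n : ℝ) - 1 < plexWeight K) (i : Fin d) (j : Fin n) : ∃ α, α i = j ∧ K α ≠ 0 := by
  by_contra! h
  have h0 : hyperplaneSum K i j = 0 := Finset.sum_eq_zero fun α _ => by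
    split_ifs with hα
    · exact h α hα
    · rfl
  have h1 : ∑ j' ∈ Finset.univ.erase j, hyperplaneSum K i j' ≤ (n : ℝ) - 1 := by
    refine (Finset.sum_le_card_nsmul _ _ 1 fun j' _ => hK.2 i j').trans ?_
    have : 1 ≤ n := j.pos
    simp [Finset.card_erase_of_mem, Nat.cast_sub this]
  have h2 := Finset.add_sum_erase Finset.univ (hyperplaneSum K i) (Finset.mem_univ j)
  rw [sum_hyperplaneSum, h0, zero_add] at h2
  linarith

/-- if δ < 1, every hyperplane contains an index covered with
weight exactly 1. -/
theorem stmt_6 (d n : ℕ) (A : (Fin d → Fin n) → ℝ) (hA : IsZeroOne A)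
    (hE : IsExtremal A) (δ : ℝ) (hδ : HasDeficiency A δ) (hδ1 : δ < 1)
    (Λ : Fin d → Fin n → ℝ) (hΛ : IsOptimalCover A Λ) :
    ∀ (i : Fin d) (j : Fin n), ∃ α : Fin d → Fin n,
      α i = j ∧ ∑ l, Λ l (α l) = 1 := by
  intro i j
  obtain ⟨⟨K, hK, hKA, hKw⟩, hmax⟩ := hδ
  obtain ⟨α, hα, hKα⟩ := hK.exists_ne_zero (by linarith) i j
  refine ⟨α, hα, sum_cover_eq_one_of_coverWeight_le hK hKA hΛ.1 ?_ hKα⟩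
  refine le_of_forall_gt_imp_ge_of_dense fun W hW => ?_
  obtain ⟨L, hL, hLW⟩ := exists_isCover_coverWeight_lt_s6 hA i (W := W) fun K' hK' hKA' =>
    (hmax ⟨K', hK', hKA', rfl⟩).trans_lt (hKw ▸ hW)
  exact (hΛ.2 L hL).trans hLW.le
end

section
/- Let d ≥ 2, let A be an extremal d-dimensional (0,1)-matrix of order n, and let Λ be an optimal hyperplane cover of A. Then the number of pairs (i,j) with λ_{i,j} > 1/2 is strictly less than n. -/
open Finset

/-- A homogeneous Farkas lemma for nonnegative combinations of vectors with positive coordinate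
sum, where only the vectors with index in `{i | g i}` may be used. -/
lemma exists_nonneg_combination {ι κ : Type*} [Fintype ι] [Fintype κ]
    (g : ι → Prop) (v : ι → κ → ℝ) (b : κ → ℝ)
    (hv : ∀ i, 0 < ∑ k, v i k) (hb : 0 < ∑ k, b k)
    (h : ∀ μ : κ → ℝ, (∀ i, g i → 0 ≤ ∑ k, μ k * v i k) → 0 ≤ ∑ k, μ k * b k) :
    ∃ w : ι → ℝ, (∀ i, 0 ≤ w i) ∧ (∀ i, ¬ g i → w i = 0) ∧
      ∀ k, ∑ i, w i * v i k = b k := by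
  classical
  set c : ι → ℝ := fun i => ∑ k, v i k with hc
  set e : ℝ := ∑ k, b k with he
  let S : Set (ι → ℝ) := stdSimplex ℝ ι ∩ {w | ∀ i, ¬ g i → w i = 0}
  let L : (ι → ℝ) →ₗ[ℝ] (κ → ℝ) :=
    ∑ i, (LinearMap.proj i : (ι → ℝ) →ₗ[ℝ] ℝ).smulRight ((c i)⁻¹ • v i)
  have hL : ∀ w k, L w k = ∑ i, w i * ((c i)⁻¹ * v i k) := by
    intro w k
    simp [L, LinearMap.sum_apply, Finset.sum_apply]
  have hclosed : IsClosed {w : ι → ℝ | ∀ i, ¬ g i → w i = 0} := by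
    simp only [Set.ofPred_forall]
    refine isClosed_iInter fun i => isClosed_iInter fun _ => ?_
    exact isClosed_eq (continuous_apply i) continuous_const
  have hconv : Convex ℝ {w : ι → ℝ | ∀ i, ¬ g i → w i = 0} := by
    intro x hx y hy a a' _ _ _ i hi
    simp [hx i hi, hy i hi]
  have hScomp : IsCompact S := (isCompact_stdSimplex ℝ ι).inter_right hclosed
  have hCclosed : IsClosed (L '' S) :=
    (hScomp.image L.continuous_of_finiteDimensional).isClosed
  have hCconv : Convex ℝ (L '' S) := ((convex_stdSimplex ℝ ι).inter hconv).linear_image L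
  by_cases hmem : e⁻¹ • b ∈ L '' S
  · obtain ⟨w, ⟨hw, hwg⟩, hwb⟩ := hmem
    refine ⟨fun i => e * (w i * (c i)⁻¹), fun i => ?_, fun i hi => ?_, fun k => ?_⟩
    · exact mul_nonneg hb.le (mul_nonneg (hw.1 i) (inv_nonneg.2 (hv i).le))
    · simp [hwg i hi]
    · have h1 := congrFun hwb k
      rw [hL] at h1
      simp only [Pi.smul_apply, smul_eq_mul] at h1
      calc ∑ i, e * (w i * (c i)⁻¹) * v i k = e * ∑ i, w i * ((c i)⁻¹ * v i k) := by
            rw [Finset.mul_sum]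
            exact Finset.sum_congr rfl fun i _ => by ring
        _ = b k := by rw [h1, mul_inv_cancel_left₀ hb.ne']
  · exfalso
    obtain ⟨f, u, hfb, hfC⟩ := geometric_hahn_banach_point_closed hCconv hCclosed hmem
    have hf : ∀ x : κ → ℝ, f x = ∑ k, f (Pi.single k 1) * x k := by
      intro x
      have := f.toLinearMap.pi_apply_eq_sum_univ x
      simp only [ContinuousLinearMap.coe_coe, smul_eq_mul] at this
      rw [this]
      refine Finset.sum_congr rfl fun k _ => ?_
      rw [mul_comm]
      congr 2
      ext j
      simp [Pi.single_apply, eq_comm]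
    have key : ∀ x : κ → ℝ,
        ∑ k, (f (Pi.single k 1) - u) * x k = f x - u * ∑ k, x k := by
      intro x
      rw [hf x, Finset.mul_sum, ← Finset.sum_sub_distrib]
      exact Finset.sum_congr rfl fun k _ => by ring
    have h2 := h (fun k => f (Pi.single k 1) - u) ?_
    · rw [key] at h2
      rw [map_smul, smul_eq_mul] at hfb
      have : e * (e⁻¹ * f b) < e * u := mul_lt_mul_of_pos_left hfb hb
      rw [mul_inv_cancel_left₀ hb.ne'] at this
      linarith
    · intro i hi
      rw [key]
      have hiC : (c i)⁻¹ • v i ∈ L '' S := by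
        refine ⟨Pi.single i 1, ⟨single_mem_stdSimplex ℝ i, fun j hj => ?_⟩, ?_⟩
        · exact Pi.single_eq_of_ne (by rintro rfl; exact hj hi) _
        · ext k
          rw [hL]
          simp [Pi.single_apply]
      have h3 := hfC _ hiC
      rw [map_smul, smul_eq_mul] at h3
      have : c i * u < c i * ((c i)⁻¹ * f (v i)) := mul_lt_mul_of_pos_left h3 (hv i)
      rw [mul_inv_cancel_left₀ (hv i).ne'] at this
      linarith

/-- A direction that is feasible to first order at an optimal cover has nonnegative weight. -/
lemma IsOptimalCover.sum_nonneg_of_feasible {d n : ℕ} {A : (Fin d → Fin n) → ℝ}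
    {Λ : Fin d → Fin n → ℝ} (hΛ : IsOptimalCover A Λ) (μ : Fin d → Fin n → ℝ)
    (hzero : ∀ i j, Λ i j = 0 → 0 ≤ μ i j)
    (htight : ∀ α, A α ≠ 0 → ∑ i, Λ i (α i) = 1 → 0 ≤ ∑ i, μ i (α i)) :
    0 ≤ coverWeight μ := by
  by_contra! hneg
  have h1 : ∀ᶠ ε in nhdsWithin (0 : ℝ) (Set.Ioi 0), ∀ i j, 0 ≤ Λ i j + ε * μ i j := by
    refine Filter.eventually_all.2 fun i => Filter.eventually_all.2 fun j => ?_
    rcases (hΛ.1.1 i j).eq_or_lt with h | h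
    · filter_upwards [self_mem_nhdsWithin] with ε hε
      have := mul_nonneg (le_of_lt hε) (hzero i j h.symm)
      linarith
    · have : Filter.Tendsto (fun ε : ℝ => Λ i j + ε * μ i j) (nhds 0) (nhds (Λ i j)) := by
        have hc : Continuous fun ε : ℝ => Λ i j + ε * μ i j := by fun_prop
        simpa using hc.tendsto 0
      exact nhdsWithin_le_nhds ((this.eventually (lt_mem_nhds h)).mono fun _ => le_of_lt)
  have h2 : ∀ᶠ ε in nhdsWithin (0 : ℝ) (Set.Ioi 0), ∀ α, A α ≠ 0 →
      1 ≤ ∑ i, Λ i (α i) + ε * ∑ i, μ i (α i) := by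
    refine Filter.eventually_all.2 fun α => Filter.eventually_imp_distrib_left.2 fun hα => ?_
    rcases (hΛ.1.2 α hα).eq_or_lt with h | h
    · filter_upwards [self_mem_nhdsWithin] with ε hε
      have := mul_nonneg (le_of_lt hε) (htight α hα h.symm)
      linarith
    · have : Filter.Tendsto (fun ε : ℝ => ∑ i, Λ i (α i) + ε * ∑ i, μ i (α i)) (nhds 0)
          (nhds (∑ i, Λ i (α i))) := by
        have hc : Continuous fun ε : ℝ => ∑ i, Λ i (α i) + ε * ∑ i, μ i (α i) := by fun_prop
        simpa using hc.tendsto 0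
      exact nhdsWithin_le_nhds ((this.eventually (lt_mem_nhds h)).mono fun _ => le_of_lt)
  obtain ⟨ε, ⟨hε1, hε2⟩, hε⟩ := ((h1.and h2).and self_mem_nhdsWithin).exists
  have hcover : IsCover A fun i j => Λ i j + ε * μ i j := by
    refine ⟨hε1, fun α hα => ?_⟩
    have := hε2 α hα
    rwa [Finset.mul_sum, ← Finset.sum_add_distrib] at this
  have hle := hΛ.2 _ hcover
  have hw : coverWeight (fun i j => Λ i j + ε * μ i j) = coverWeight Λ + ε * coverWeight μ := by
    simp only [coverWeight, Finset.sum_add_distrib, Finset.mul_sum]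
  have : ε * coverWeight μ < 0 := mul_neg_of_pos_of_neg hε hneg
  linarith

/-- Complementary slackness: an optimal cover has a matching polyplex, supported on indices
covered exactly once and saturating every hyperplane of positive weight. -/
lemma IsOptimalCover.exists_complementary_polyplex {d n : ℕ} (hd : 0 < d) (hn : 0 < n)
    {A : (Fin d → Fin n) → ℝ} {Λ : Fin d → Fin n → ℝ} (hΛ : IsOptimalCover A Λ) :
    ∃ K, IsPolyplex K ∧ ContainedIn K A ∧ (∀ α, K α ≠ 0 → ∑ i, Λ i (α i) = 1) ∧
      ∀ i j, 0 < Λ i j → (∑ α : Fin d → Fin n, if α i = j then K α else 0) = 1 := by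
  classical
  have hcomb := exists_nonneg_combination
    (ι := (Fin d → Fin n) ⊕ (Fin d × Fin n)) (κ := Fin d × Fin n)
    (Sum.elim (fun α => A α ≠ 0 ∧ ∑ i, Λ i (α i) = 1) (fun p => Λ p.1 p.2 = 0))
    (Sum.elim (fun α p => if α p.1 = p.2 then 1 else 0) (fun q p => if q = p then 1 else 0))
    (fun _ => 1) ?_ ?_ ?_
  · obtain ⟨w, hw0, hwg, hw⟩ := hcomb
    have hs : ∀ i j, (∑ α : Fin d → Fin n, if α i = j then w (Sum.inl α) else 0)
        + w (Sum.inr (i, j)) = 1 := by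
      intro i j
      simpa [Fintype.sum_sum_type] using hw (i, j)
    have hT : ∀ α, w (Sum.inl α) ≠ 0 → A α ≠ 0 ∧ ∑ i, Λ i (α i) = 1 := by
      intro α hα
      by_contra hcon
      exact hα (hwg (Sum.inl α) hcon)
    refine ⟨fun α => w (Sum.inl α), ⟨fun α => hw0 _, fun i j => ?_⟩,
      fun α hα => (hT α hα).1, fun α hα => (hT α hα).2, fun i j hij => ?_⟩
    · linarith [hs i j, hw0 (Sum.inr (i, j))]
    · have := hwg (Sum.inr (i, j)) hij.ne'
      linarith [hs i j]
  · rintro (α | q)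
    · simp only [Sum.elim_inl, Finset.sum_boole, Nat.cast_pos, Finset.card_pos]
      exact ⟨(⟨0, hd⟩, α ⟨0, hd⟩), by simp⟩
    · simp
  · simp [hd, hn]
  · intro μ hμ
    have := hΛ.sum_nonneg_of_feasible (fun i j => μ (i, j)) (fun i j hij => ?_)
      (fun α hα h1 => ?_)
    · simpa [coverWeight, Fintype.sum_prod_type] using this
    · simpa using hμ (Sum.inr (i, j)) hij
    · simpa [Fintype.sum_prod_type] using hμ (Sum.inl α) ⟨hα, h1⟩

/-- The hyperplanes of one direction partition the weight of a matrix. -/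
lemma sum_hyperplanes_eq_plexWeight {d n : ℕ} (K : (Fin d → Fin n) → ℝ) (i : Fin d) :
    (∑ j, ∑ α : Fin d → Fin n, if α i = j then K α else 0) = plexWeight K := by
  rw [Finset.sum_comm]
  simp [plexWeight]

lemma IsPolyplex.plexWeight_le {d n : ℕ} (hd : 0 < d) {K : (Fin d → Fin n) → ℝ}
    (hK : IsPolyplex K) : plexWeight K ≤ n := by
  rw [← sum_hyperplanes_eq_plexWeight K ⟨0, hd⟩]
  refine (Finset.sum_le_sum fun j _ => hK.2 _ j).trans ?_
  simp

/-- An index covered exactly once lies on at most one hyperplane of weight more than `1/2`. -/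
lemma card_heavy_hyperplanes_le_one {d n : ℕ} {Λ : Fin d → Fin n → ℝ}
    (h0 : ∀ i j, 0 ≤ Λ i j) {α : Fin d → Fin n} (hα : ∑ i, Λ i (α i) = 1) :
    ((univ : Finset (Fin d × Fin n)).filter
      (fun p => (1 : ℝ) / 2 < Λ p.1 p.2 ∧ α p.1 = p.2)).card ≤ 1 := by
  refine Finset.card_le_one.2 ?_
  rintro ⟨i, j⟩ hp ⟨i', j'⟩ hq
  obtain ⟨hp, hj⟩ := (Finset.mem_filter.1 hp).2
  obtain ⟨hq, hj'⟩ := (Finset.mem_filter.1 hq).2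
  simp only at hp hq hj hj'
  subst hj hj'
  by_contra hne
  have hii : i ≠ i' := fun h => hne (by subst h; rfl)
  have hle := Finset.sum_le_univ_sum_of_nonneg (s := {i, i'}) (f := fun i => Λ i (α i))
    (fun i => h0 i (α i))
  rw [Finset.sum_pair hii, hα] at hle
  linarith


/-- the number of entries greater than 1/2 in an optimal cover
is less than n. -/
theorem stmt_10 (d n : ℕ) (hd : 2 ≤ d) (A : (Fin d → Fin n) → ℝ)
    (hA : IsZeroOne A) (hE : IsExtremal A)
    (Λ : Fin d → Fin n → ℝ) (hΛ : IsOptimalCover A Λ) :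
    ((univ : Finset (Fin d × Fin n)).filter
        (fun p => (1 : ℝ) / 2 < Λ p.1 p.2)).card < n := by
  classical
  have hd0 : 0 < d := by omega
  have hn : 0 < n := by
    rcases Nat.eq_zero_or_pos n with rfl | hn
    · exact absurd ⟨0, by simp [IsPolyplex], by simp [ContainedIn], by simp [plexWeight]⟩ hE.1
    · exact hn
  obtain ⟨K, hK, hKA, htight, hsat⟩ := hΛ.exists_complementary_polyplex hd0 hn
  have hlt : plexWeight K < n :=
    lt_of_le_of_ne (hK.plexWeight_le hd0) fun h => hE.1 ⟨K, hK, hKA, h⟩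
  set B := (univ : Finset (Fin d × Fin n)).filter (fun p => (1 : ℝ) / 2 < Λ p.1 p.2) with hB
  have hcard : (B.card : ℝ) ≤ plexWeight K := by
    calc (B.card : ℝ)
        = ∑ p ∈ B, ∑ α : Fin d → Fin n, if α p.1 = p.2 then K α else 0 := by
          rw [Finset.card_eq_sum_ones, Nat.cast_sum]
          refine Finset.sum_congr rfl fun p hp => ?_
          have hp' := (Finset.mem_filter.1 hp).2
          rw [hsat p.1 p.2 (by linarith), Nat.cast_one]
      _ = ∑ α, ∑ p ∈ B, if α p.1 = p.2 then K α else 0 := Finset.sum_comm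
      _ ≤ ∑ α, K α := by
          refine Finset.sum_le_sum fun α _ => ?_
          rw [← Finset.sum_filter, Finset.sum_const, nsmul_eq_mul, hB, Finset.filter_filter]
          by_cases hα : K α = 0
          · simp [hα]
          · have h1 := card_heavy_hyperplanes_le_one hΛ.1.1 (htight α hα)
            exact mul_le_of_le_one_left (hK.1 α) (by exact_mod_cast h1)
  exact_mod_cast hcard.trans_lt hlt
end

section
/- Let d ≥ 2, let A be a (d−1)-dimensional (0,1)-matrix of order n, and let B be the d-dimensional (0,1)-matrix of order n defined by b_{(α_1,…,α_{d−1},α_d)} = a_{(α_1,…,α_{d−1})} for all indices (so every hyperplane of direction d of B equals A). Then B is an extremal matrix with deficiency δ if and only if A is an extremal matrix with deficiency δ. -/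
open Finset

theorem sum_snoc {d n : ℕ} (f : (Fin (d + 1) → Fin n) → ℝ) :
    ∑ γ, f γ = ∑ α : Fin d → Fin n, ∑ l : Fin n, f (Fin.snoc (α := fun _ => Fin n) α l) := by
  rw [← (Fin.snocEquiv (fun _ : Fin (d + 1) => Fin n)).sum_comp, Fintype.sum_prod_type_right]
  rfl

/-- The projection of a matrix along its last direction. -/
def projectLast {d n : ℕ} (L : (Fin (d + 1) → Fin n) → ℝ) (α : Fin d → Fin n) : ℝ :=
  ∑ l : Fin n, L (Fin.snoc (α := fun _ => Fin n) α l)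

theorem plexWeight_projectLast {d n : ℕ} (L : (Fin (d + 1) → Fin n) → ℝ) :
    plexWeight (projectLast L) = plexWeight L :=
  (sum_snoc L).symm

theorem sum_hyperplane_castSucc {d n : ℕ} (L : (Fin (d + 1) → Fin n) → ℝ) (i : Fin d)
    (j : Fin n) :
    (∑ γ : Fin (d + 1) → Fin n, if γ i.castSucc = j then L γ else 0) =
      ∑ α : Fin d → Fin n, if α i = j then projectLast L α else 0 := by
  rw [sum_snoc]
  refine sum_congr rfl fun α _ => ?_
  by_cases h : α i = j <;> simp [h, projectLast]

theorem sum_hyperplane_last {d n : ℕ} (L : (Fin (d + 1) → Fin n) → ℝ) (j : Fin n) :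
    (∑ γ : Fin (d + 1) → Fin n, if γ (Fin.last d) = j then L γ else 0) =
      ∑ α : Fin d → Fin n, L (Fin.snoc (α := fun _ => Fin n) α j) := by
  rw [sum_snoc]
  refine sum_congr rfl fun α _ => ?_
  simp

theorem IsPolyplex.projectLast {d n : ℕ} {L : (Fin (d + 1) → Fin n) → ℝ} (hL : IsPolyplex L) :
    IsPolyplex (projectLast L) :=
  ⟨fun _ => sum_nonneg fun _ _ => hL.1 _,
    fun i j => (sum_hyperplane_castSucc L i j).symm.trans_le (hL.2 i.castSucc j)⟩

theorem IsPolyplex.of_projectLast {d n : ℕ} {L : (Fin (d + 1) → Fin n) → ℝ}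
    (h0 : ∀ γ, 0 ≤ L γ) (hp : IsPolyplex (_root_.projectLast L))
    (hl : ∀ j, ∑ α : Fin d → Fin n, L (Fin.snoc (α := fun _ => Fin n) α j) ≤ 1) :
    IsPolyplex L := by
  refine ⟨h0, fun i j => ?_⟩
  induction i using Fin.lastCases with
  | last => exact (sum_hyperplane_last L j).trans_le (hl j)
  | cast i => exact (sum_hyperplane_castSucc L i j).trans_le (hp.2 i j)

theorem ContainedIn.projectLast {d n : ℕ} {L B : (Fin (d + 1) → Fin n) → ℝ}
    {A : (Fin d → Fin n) → ℝ} (hL : ContainedIn L B)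
    (hBA : ∀ α l, B (Fin.snoc (α := fun _ => Fin n) α l) ≠ 0 → A α ≠ 0) :
    ContainedIn (projectLast L) A := by
  intro α hα
  obtain ⟨l, -, hl⟩ := exists_ne_zero_of_sum_ne_zero hα
  exact hBA α l (hL _ hl)

theorem IsPolyplex.entry_le_one {d n : ℕ} (hd : 1 ≤ d) {K : (Fin d → Fin n) → ℝ}
    (hK : IsPolyplex K) (α : Fin d → Fin n) : K α ≤ 1 := by
  refine le_trans ?_ (hK.2 ⟨0, hd⟩ (α ⟨0, hd⟩))
  have h := single_le_sum
    (f := fun γ : Fin d → Fin n => if γ ⟨0, hd⟩ = α ⟨0, hd⟩ then K γ else 0)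
    (fun γ _ => by
      by_cases h : γ ⟨0, hd⟩ = α ⟨0, hd⟩
      · simpa [h] using hK.1 γ
      · simp [h]) (mem_univ α)
  simpa using h

theorem IsPolyplex.weight_le {d n : ℕ} (hd : 1 ≤ d) {K : (Fin d → Fin n) → ℝ}
    (hK : IsPolyplex K) : plexWeight K ≤ n := by
  calc plexWeight K
      = ∑ j : Fin n, ∑ α : Fin d → Fin n, if α ⟨0, hd⟩ = j then K α else 0 := by
        rw [sum_comm]
        simp [plexWeight]
    _ ≤ ∑ _j : Fin n, (1 : ℝ) := sum_le_sum fun j _ => hK.2 _ j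
    _ = n := by simp

/-- Spreading a polyplex evenly over the layers of the last direction preserves its weight. -/
theorem polyplexWeights_eq_of_layers_eq {d n : ℕ} (hd : 1 ≤ d) {A : (Fin d → Fin n) → ℝ}
    {B : (Fin (d + 1) → Fin n) → ℝ} (hB : ∀ β, B β = A (fun i => β i.castSucc)) :
    polyplexWeights B = polyplexWeights A := by
  ext W
  constructor
  · rintro ⟨L, hL, hLB, rfl⟩
    exact ⟨projectLast L, hL.projectLast, hLB.projectLast fun α l h => by simpa [hB] using h,
      plexWeight_projectLast L⟩
  · rintro ⟨K, hK, hKA, rfl⟩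
    let L : (Fin (d + 1) → Fin n) → ℝ := fun γ => K (fun i => γ i.castSucc) / n
    have hLK : projectLast L = K := by
      funext α
      have hn : (n : ℝ) ≠ 0 := by
        have := (α ⟨0, hd⟩).pos
        positivity
      simp only [projectLast, L, Fin.snoc_castSucc, sum_const, card_univ, Fintype.card_fin,
        nsmul_eq_mul]
      field_simp
    refine ⟨L, .of_projectLast (fun γ => div_nonneg (hK.1 _) n.cast_nonneg) (hLK ▸ hK) ?_, ?_, ?_⟩
    · intro j
      have hn : (0 : ℝ) < n := by exact_mod_cast j.pos
      simp only [L, Fin.snoc_castSucc]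
      rw [← sum_div, div_le_one hn]
      exact hK.weight_le hd
    · intro γ hγ
      rw [hB]
      exact hKA _ (div_ne_zero_iff.1 hγ).1
    · rw [← plexWeight_projectLast, hLK]

/-- A polydiagonal of `A` with the entry `α` added lifts to one of `B` with a single added entry
over `α`: all the weight at `α` goes to that entry, and the remaining weight is spread over the
layers in proportion to the room left in them. -/
theorem HasPolydiagonal.lift_update {d n : ℕ} (hd : 1 ≤ d) {A : (Fin d → Fin n) → ℝ}
    {B : (Fin (d + 1) → Fin n) → ℝ} (hB : ∀ β, B β = A (fun i => β i.castSucc))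
    {β : Fin (d + 1) → Fin n}
    (h : HasPolydiagonal (Function.update A (fun i => β i.castSucc) 1)) :
    HasPolydiagonal (Function.update B β 1) := by
  obtain ⟨K, hK, hKA, hKn⟩ := h
  set α : Fin d → Fin n := fun i => β i.castSucc
  set j := β (Fin.last d)
  have h1 : K α ≤ 1 := hK.entry_le_one hd α
  have hrest : ∑ γ ∈ univ.erase α, K γ = n - K α := by
    rw [← hKn, plexWeight, ← add_sum_erase _ K (mem_univ α)]
    ring
  have hR : 0 ≤ (n : ℝ) - K α := hrest ▸ sum_nonneg fun γ _ => hK.1 γ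
  let t : Fin n → ℝ := fun l => if l = j then K α else 0
  have ht0 : ∀ l, 0 ≤ t l := fun l => by
    by_cases h : l = j <;> simp [t, h, hK.1 α]
  have ht1 : ∀ l, t l ≤ 1 := fun l => by
    by_cases h : l = j <;> simp [t, h, h1]
  let w : Fin n → ℝ := fun l => (1 - t l) / (n - K α)
  have hw0 : ∀ l, 0 ≤ w l := fun l => div_nonneg (sub_nonneg.2 (ht1 l)) hR
  have hw : ∀ γ, γ ≠ α → ∑ l, K γ * w l = K γ := by
    intro γ hγ
    rw [← mul_sum, ← sum_div]
    have hsum : ∑ l, (1 - t l) = n - K α := by simp [t]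
    rw [hsum]
    rcases eq_or_ne ((n : ℝ) - K α) 0 with h0 | h0
    · have : K γ = 0 :=
        (sum_eq_zero_iff_of_nonneg fun γ _ => hK.1 γ).1 (hrest.trans h0) γ
          (mem_erase.2 ⟨hγ, mem_univ γ⟩)
      simp [this]
    · rw [div_self h0, mul_one]
  let c : (Fin d → Fin n) → Fin n → ℝ := fun γ l => if γ = α then t l else K γ * w l
  let L : (Fin (d + 1) → Fin n) → ℝ := fun γ => c (fun i => γ i.castSucc) (γ (Fin.last d))
  have hc0 : ∀ γ l, 0 ≤ c γ l := fun γ l => by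
    by_cases h : γ = α
    · simpa [c, h] using ht0 l
    · simpa [c, h] using mul_nonneg (hK.1 γ) (hw0 l)
  have hLK : projectLast L = K := by
    funext γ
    simp only [projectLast, L, Fin.snoc_castSucc, Fin.snoc_last]
    by_cases h : γ = α
    · simp [c, h, t]
    · simpa [c, h] using hw γ h
  refine ⟨L, .of_projectLast (fun γ => hc0 _ _) (hLK ▸ hK) ?_, ?_, ?_⟩
  · intro l
    simp only [L, Fin.snoc_castSucc, Fin.snoc_last]
    rw [← add_sum_erase _ _ (mem_univ α)]
    have hcl : ∑ γ ∈ univ.erase α, c γ l = (n - K α) * w l := by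
      rw [← hrest, sum_mul]
      exact sum_congr rfl fun γ hγ => by simp [c, ne_of_mem_erase hγ]
    rw [hcl]
    have hcα : c α l = t l := by simp [c]
    rw [hcα]
    rcases eq_or_ne ((n : ℝ) - K α) 0 with h0 | h0
    · simpa [h0] using ht1 l
    · simp [w, mul_div_cancel₀ _ h0]
  · intro γ hγ
    by_cases hγβ : γ = β
    · simp [hγβ]
    rw [Function.update_of_ne hγβ, hB]
    by_cases h : (fun i : Fin d => γ i.castSucc) = α
    · have hne : γ (Fin.last d) ≠ j := by
        intro hl
        apply hγβ
        funext i
        induction i using Fin.lastCases with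
        | last => exact hl
        | cast i => exact congrFun h i
      simp [L, c, h, t, hne] at hγ
    · have hKγ : K (fun i => γ i.castSucc) ≠ 0 := by
        intro h0
        simp [L, c, h, h0] at hγ
      simpa [h] using hKA _ hKγ
  · rw [← plexWeight_projectLast, hLK, hKn]

theorem HasPolydiagonal.project_update {d n : ℕ} {A : (Fin d → Fin n) → ℝ}
    {B : (Fin (d + 1) → Fin n) → ℝ} (hB : ∀ β, B β = A (fun i => β i.castSucc))
    {α : Fin d → Fin n} {j : Fin n}
    (h : HasPolydiagonal (Function.update B (Fin.snoc (α := fun _ => Fin n) α j) 1)) :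
    HasPolydiagonal (Function.update A α 1) := by
  obtain ⟨L, hL, hLB, hLn⟩ := h
  refine ⟨projectLast L, hL.projectLast, hLB.projectLast fun γ l hγ => ?_,
    (plexWeight_projectLast L).trans hLn⟩
  by_cases hγα : γ = α
  · simp [hγα]
  · have hne : Fin.snoc (α := fun _ => Fin n) γ l ≠ Fin.snoc (α := fun _ => Fin n) α j :=
      fun h => hγα (Fin.snoc_inj.1 h).1
    rw [Function.update_of_ne hne, hB] at hγ
    rw [Function.update_of_ne hγα]
    simpa using hγ

/-- a matrix all of whose hyperplanes of one direction equal A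
is extremal of deficiency δ iff A is. -/
theorem stmt_12 (d n : ℕ) (hd : 1 ≤ d)
    (A : (Fin d → Fin n) → ℝ) (hA : IsZeroOne A)
    (B : (Fin (d + 1) → Fin n) → ℝ)
    (hB : ∀ β : Fin (d + 1) → Fin n, B β = A (fun i => β i.castSucc))
    (δ : ℝ) :
    (IsExtremal B ∧ HasDeficiency B δ) ↔ (IsExtremal A ∧ HasDeficiency A δ) := by
  have hW : polyplexWeights B = polyplexWeights A := polyplexWeights_eq_of_layers_eq hd hB
  have hdiag : HasPolydiagonal B ↔ HasPolydiagonal A := Set.ext_iff.1 hW n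
  have hdef : HasDeficiency B δ ↔ HasDeficiency A δ := by
    rw [HasDeficiency, HasDeficiency, hW]
  rw [hdef, IsExtremal, IsExtremal, hdiag]
  refine and_congr_left' (and_congr_right' ⟨fun h α hα => ?_, fun h β hβ => ?_⟩)
  · exact (h (Fin.snoc (α := fun _ => Fin n) α (α ⟨0, hd⟩)) (by simpa [hB] using hα)).project_update
      hB
  · exact (h _ (hB β ▸ hβ)).lift_update hd hB
end

section
/- Let m, d, n be positive integers with m < d, and let Λ be a d×n table all of whose entries lie in {0, 1/m}, whose weight W = ∑_{i,j} λ_{i,j} satisfies W ≤ n. Then the (0,1)-matrix A(Λ) contains a polyplex of weight W if and only if for every row i of Λ the number of nonzero entries in row i is at most W. -/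
open Finset

theorem exists_mem_step (C : ℕ → ℕ) (h0 : C 0 = 0) {d x : ℕ} (hx : x < C d) :
    ∃ i < d, C i ≤ x ∧ x < C (i + 1) := by
  induction d with
  | zero => omega
  | succ d ih =>
    by_cases h : x < C d
    · obtain ⟨i, hi, h'⟩ := ih h
      exact ⟨i, by omega, h'⟩
    · exact ⟨d, by omega, by omega, hx⟩

theorem injOn_mod_Ico {N c a : ℕ} (ha : a ≤ N) :
    Set.InjOn (· % N) (Ico c (c + a) : Finset ℕ) := by
  intro x hx y hy hxy
  simp only [coe_Ico, Set.mem_Ico] at hx hy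
  have hxy : x ≡ y [MOD N] := hxy
  rcases le_total x y with h | h
  · have := Nat.eq_zero_of_dvd_of_lt ((Nat.modEq_iff_dvd' h).1 hxy) (by omega)
    omega
  · have := Nat.eq_zero_of_dvd_of_lt ((Nat.modEq_iff_dvd' h).1 hxy.symm) (by omega)
    omega

/-- Wrapping consecutive intervals of lengths `a i ≤ N` around a cycle of length `N` gives
sets of sizes `a i` covering every point `m` times, when `∑ i, a i = m * N`. -/
theorem exists_cyclic_cover {m d N : ℕ} (a : Fin d → ℕ) (ha : ∀ i, a i ≤ N)
    (hsum : ∑ i, a i = m * N) :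
    ∃ T : Fin d → Finset (Fin N), (∀ i, (T i).card = a i) ∧
      ∀ k, m ≤ (univ.filter fun i => k ∈ T i).card := by
  classical
  let b : ℕ → ℕ := fun i => if h : i < d then a ⟨i, h⟩ else 0
  let C : ℕ → ℕ := fun t => ∑ i ∈ range t, b i
  have hb (i : Fin d) : b i = a i := by simp [b]
  have hC (i : Fin d) : C (i + 1) = C i + a i := by
    simp only [C, sum_range_succ, hb]
  have hCd : C d = m * N := by
    simp only [C, ← hsum, ← Fin.sum_univ_eq_sum_range, hb]
  refine ⟨fun i => univ.filter fun k => ∃ x ∈ Ico (C i) (C i + a i), x % N = k, ?_, ?_⟩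
  · intro i
    rw [← card_map Fin.valEmbedding]
    calc _ = ((Ico (C i) (C i + a i)).image (· % N)).card := by
          congr 1
          ext y
          simp only [mem_map, mem_filter, mem_univ, true_and, mem_image, Fin.valEmbedding_apply]
          constructor
          · rintro ⟨k, ⟨x, hx, hk⟩, rfl⟩
            exact ⟨x, hx, hk⟩
          · rintro ⟨x, hx, rfl⟩
            have hN : 0 < N := by
              have := mem_Ico.1 hx
              have := ha i
              omega
            exact ⟨⟨x % N, Nat.mod_lt _ hN⟩, ⟨x, hx, rfl⟩, rfl⟩
      _ = a i := by
          rw [card_image_of_injOn (injOn_mod_Ico (ha i))]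
          simp
  · intro k
    have hlt (r : Fin m) : (k : ℕ) + r * N < C d := by
      rw [hCd]
      calc (k : ℕ) + r * N < N + r * N := by omega
        _ = (r + 1) * N := by ring
        _ ≤ m * N := Nat.mul_le_mul_right _ r.2
    choose row hrow hlo hhi using fun r => exists_mem_step C (by simp [C]) (hlt r)
    have hhi' (r : Fin m) : (k : ℕ) + r * N < C (row r) + a ⟨row r, hrow r⟩ := by
      rw [← hC ⟨row r, hrow r⟩]
      exact hhi r
    have hmod (r : Fin m) : ((k : ℕ) + r * N) % N = k := by
      rw [Nat.add_mul_mod_self_right, Nat.mod_eq_of_lt k.2]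
    calc m = (univ : Finset (Fin m)).card := by simp
      _ ≤ _ := card_le_card_of_injOn (fun r => (⟨row r, hrow r⟩ : Fin d)) ?_ ?_
    · intro r _
      simpa using ⟨(k : ℕ) + r * N, ⟨hlo r, hhi' r⟩, hmod r⟩
    · intro r _ r' _ h
      have h : row r = row r' := by simpa using h
      have hrr : (k : ℕ) + r * N = k + r' * N := by
        refine injOn_mod_Ico (ha ⟨row r, hrow r⟩) (c := C (row r)) ?_ ?_
          ((hmod r).trans (hmod r').symm)
        · simpa using ⟨hlo r, hhi' r⟩
        · have h1 := hlo r'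
          have h2 := hhi' r'
          simp only [← h] at h1 h2
          simpa using ⟨h1, h2⟩
      have hN : 0 < N := k.pos
      exact Fin.ext (Nat.eq_of_mul_eq_mul_right hN (by omega))

theorem exists_map_card_fiber_le {α β : Type*} [Fintype α] [Fintype β] [DecidableEq α]
    [DecidableEq β] {m : ℕ} (T : Finset α) (S : Finset β) (h : T.card ≤ m * S.card)
    (h' : Tᶜ.card ≤ m * Sᶜ.card) :
    ∃ f : α → β, (∀ k ∈ T, f k ∈ S) ∧ ∀ j, (univ.filter fun k => f k = j).card ≤ m := by
  have key (T : Finset α) (S : Finset β) (h : T.card ≤ m * S.card) :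
      Nonempty (T ↪ S × Fin m) :=
    Function.Embedding.nonempty_of_card_le (by simpa [mul_comm] using h)
  obtain ⟨u⟩ := key T S h
  obtain ⟨v⟩ := key Tᶜ Sᶜ h'
  let g : α → β × Fin m := fun k =>
    if hk : k ∈ T then ((u ⟨k, hk⟩).1, (u ⟨k, hk⟩).2)
    else ((v ⟨k, mem_compl.2 hk⟩).1, (v ⟨k, mem_compl.2 hk⟩).2)
  have hgT (k) (hk : k ∈ T) : (g k).1 ∈ S := by simp [g, hk]
  have hgT' (k) (hk : k ∉ T) : (g k).1 ∉ S := by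
    simpa [g, hk] using mem_compl.1 (v ⟨k, mem_compl.2 hk⟩).1.2
  have hg : Function.Injective g := by
    intro x y hxy
    by_cases hx : x ∈ T <;> by_cases hy : y ∈ T
    · simp only [g, hx, hy, dif_pos, Prod.mk.injEq] at hxy
      simpa using u.injective (Prod.ext (Subtype.ext hxy.1) hxy.2)
    · exact absurd (hxy ▸ hgT x hx) (hgT' y hy)
    · exact absurd (hxy ▸ hgT y hy) (hgT' x hx)
    · simp only [g, hx, hy, dif_neg, not_false_eq_true, Prod.mk.injEq] at hxy
      simpa using v.injective (Prod.ext (Subtype.ext hxy.1) hxy.2)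
  refine ⟨fun k => (g k).1, hgT, fun j => ?_⟩
  calc _ ≤ (univ : Finset (Fin m)).card := by
        refine card_le_card_of_injOn (fun k => (g k).2) (fun _ _ => by simp) ?_
        intro x hx y hy hxy
        simp only [coe_filter, mem_univ, true_and, Set.mem_ofPred_eq] at hx hy
        exact hg (Prod.ext (hx.trans hy.symm) hxy)
    _ = m := by simp

theorem sum_mul_sum_apply {d n : ℕ} (K : (Fin d → Fin n) → ℝ) (Λ : Fin d → Fin n → ℝ) :
    ∑ α, K α * ∑ i, Λ i (α i) =
      ∑ i, ∑ j, Λ i j * ∑ α : Fin d → Fin n, if α i = j then K α else 0 := by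
  simp_rw [mul_sum]
  rw [sum_comm]
  refine sum_congr rfl fun i _ => ?_
  rw [sum_comm]
  refine sum_congr rfl fun α _ => ?_
  simp [mul_comm]

/-- A polyplex supported in `A(Λ)` with the weight of `Λ` saturates every hyperplane of
positive weight. -/
theorem hyperplane_sum_eq_one {d n : ℕ} {Λ : Fin d → Fin n → ℝ} (hΛ : ∀ i j, 0 ≤ Λ i j)
    {K : (Fin d → Fin n) → ℝ} (hK : IsPolyplex K) (hKA : ContainedIn K (matOf Λ))
    (hw : plexWeight K = coverWeight Λ) {i : Fin d} {j : Fin n} (hij : Λ i j ≠ 0) :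
    (∑ α : Fin d → Fin n, if α i = j then K α else 0) = 1 := by
  have hterm (i j) : Λ i j * (∑ α : Fin d → Fin n, if α i = j then K α else 0) ≤ Λ i j :=
    mul_le_of_le_one_right (hΛ i j) (hK.2 i j)
  have hrow (i) : ∑ j, Λ i j * (∑ α : Fin d → Fin n, if α i = j then K α else 0) ≤
      ∑ j, Λ i j := sum_le_sum fun j _ => hterm i j
  have hlow : plexWeight K ≤ ∑ α, K α * ∑ i, Λ i (α i) := by
    refine sum_le_sum fun α _ => ?_
    by_cases h : K α = 0
    · simp [h]
    · have h1 : 1 ≤ ∑ i, Λ i (α i) := by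
        by_contra hlt
        exact hKA α h (by simp [matOf, hlt])
      exact le_mul_of_one_le_right (hK.1 α) h1
  rw [sum_mul_sum_apply, hw] at hlow
  have heq := (sum_eq_sum_iff_of_le fun i _ => hrow i).1
    (le_antisymm (sum_le_sum fun i _ => hrow i) hlow) i (mem_univ i)
  have heq' := (sum_eq_sum_iff_of_le fun j _ => hterm i j).1 heq j (mem_univ j)
  exact (mul_eq_left₀ hij).1 heq'

/-- The matrix that puts weight `1 / m` on every member of a finite family of indices. -/
noncomputable def familyMatrix {d n N : ℕ} (m : ℕ) (f : Fin N → Fin d → Fin n) :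
    (Fin d → Fin n) → ℝ :=
  fun α => ∑ k, if f k = α then 1 / (m : ℝ) else 0

theorem plexWeight_familyMatrix {d n N : ℕ} (m : ℕ) (f : Fin N → Fin d → Fin n) :
    plexWeight (familyMatrix m f) = N / m := by
  simp only [plexWeight, familyMatrix]
  rw [sum_comm]
  simp [div_eq_mul_inv]

theorem hyperplane_sum_familyMatrix {d n N : ℕ} (m : ℕ) (f : Fin N → Fin d → Fin n)
    (i : Fin d) (j : Fin n) :
    (∑ α : Fin d → Fin n, if α i = j then familyMatrix m f α else 0) =
      (univ.filter fun k => f k i = j).card / m := by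
  have h (α : Fin d → Fin n) : (if α i = j then familyMatrix m f α else 0) =
      ∑ k, if f k = α then (if f k i = j then 1 / (m : ℝ) else 0) else 0 := by
    split_ifs with hα
    · refine sum_congr rfl fun k _ => ?_
      by_cases hk : f k = α
      · subst hk
        simp [hα]
      · simp [hk]
    · refine (sum_eq_zero fun k _ => ?_).symm
      by_cases hk : f k = α
      · subst hk
        simp [hα]
      · simp [hk]
  simp_rw [h]
  rw [sum_comm]
  simp [← sum_filter, div_eq_mul_inv]

theorem exists_of_familyMatrix_ne_zero {d n N m : ℕ} {f : Fin N → Fin d → Fin n}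
    {α : Fin d → Fin n} (h : familyMatrix m f α ≠ 0) : ∃ k, f k = α := by
  obtain ⟨k, -, hk⟩ := exists_ne_zero_of_sum_ne_zero h
  exact ⟨k, by by_contra h'; simp [h'] at hk⟩

theorem sum_eq_card_div {ι : Type*} [Fintype ι] {m : ℕ} (g : ι → ℝ)
    (hg : ∀ i, g i = 0 ∨ g i = 1 / (m : ℝ)) :
    ∑ i, g i = (univ.filter fun i => g i ≠ 0).card / m := by
  have h : ∀ i, g i = if g i ≠ 0 then 1 / (m : ℝ) else 0 := by
    intro i
    rcases hg i with h | h
    · simp [h]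
    · by_cases h0 : g i = 0
      · simp [h0]
      · rw [if_pos h0, h]
  calc _ = ∑ i, if g i ≠ 0 then 1 / (m : ℝ) else 0 := sum_congr rfl fun i _ => h i
    _ = _ := by rw [← sum_filter]; simp [div_eq_mul_inv]

/-- criterion for A(Λ) with entries in {0, 1/m} to contain a
polyplex of the same weight as Λ. -/
theorem stmt_14 (m d n : ℕ) (hm : 0 < m) (hmd : m < d) (hn : 0 < n)
    (Λ : Fin d → Fin n → ℝ)
    (hval : ∀ i j, Λ i j = 0 ∨ Λ i j = 1 / (m : ℝ))
    (W : ℝ) (hW : coverWeight Λ = W) (hWn : W ≤ (n : ℝ)) :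
    (∃ K : (Fin d → Fin n) → ℝ,
        IsPolyplex K ∧ ContainedIn K (matOf Λ) ∧ plexWeight K = W) ↔
    (∀ i : Fin d,
        (((univ : Finset (Fin n)).filter (fun j => Λ i j ≠ 0)).card : ℝ) ≤ W) := by
  have hm' : (0 : ℝ) < m := by exact_mod_cast hm
  have hΛ (i j) : 0 ≤ Λ i j := by
    rcases hval i j with h | h <;> rw [h]
    positivity
  constructor
  · rintro ⟨K, hK, hKA, hKW⟩ i
    have hsat (j) (hj : j ∈ univ.filter fun j => Λ i j ≠ 0) :
        (∑ α : Fin d → Fin n, if α i = j then K α else 0) = 1 :=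
      hyperplane_sum_eq_one hΛ hK hKA (hKW.trans hW.symm) (mem_filter.1 hj).2
    calc _ = ∑ j ∈ univ.filter (fun j => Λ i j ≠ 0),
          ∑ α : Fin d → Fin n, if α i = j then K α else 0 := by
          rw [sum_congr rfl hsat]
          simp
      _ ≤ ∑ j, ∑ α : Fin d → Fin n, if α i = j then K α else 0 := by
          refine sum_le_sum_of_subset_of_nonneg (filter_subset _ _) fun j _ _ => ?_
          exact sum_nonneg fun α _ => by split_ifs <;> simp [hK.1]
      _ = W := by
          rw [sum_comm, ← hKW]
          simp [plexWeight]
  · intro hs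
    let S : Fin d → Finset (Fin n) := fun i => univ.filter fun j => Λ i j ≠ 0
    let N : ℕ := ∑ i, (S i).card
    have hNW : (N : ℝ) / m = W := by
      rw [← hW]
      simp only [coverWeight, N, S, sum_eq_card_div _ (hval _), Nat.cast_sum, sum_div]
    have hNW' : (N : ℝ) = W * m := by rw [← hNW]; field_simp
    have hsN (i) : m * (S i).card ≤ N := by
      have : (m : ℝ) * (S i).card ≤ N := by
        rw [hNW', mul_comm W]
        exact mul_le_mul_of_nonneg_left (hs i) hm'.le
      exact_mod_cast this
    have hNn : N ≤ m * n := by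
      have : (N : ℝ) ≤ m * n := by
        rw [hNW', mul_comm W]
        exact mul_le_mul_of_nonneg_left hWn hm'.le
      exact_mod_cast this
    obtain ⟨T, hT, hcov⟩ := exists_cyclic_cover (m := m) (fun i => m * (S i).card) hsN
      (by simp [N, mul_sum])
    have hmap (i) := exists_map_card_fiber_le (m := m) (T i) (S i) (hT i).le (by
      rw [card_compl, card_compl, hT, Nat.mul_sub]
      simpa using Nat.sub_le_sub_right hNn _)
    choose f hfS hfm using hmap
    refine ⟨familyMatrix m fun k i => f i k, ⟨fun α => ?_, fun i j => ?_⟩, fun α hα => ?_, ?_⟩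
    · exact sum_nonneg fun k _ => by split_ifs <;> positivity
    · rw [hyperplane_sum_familyMatrix, div_le_one hm']
      exact_mod_cast hfm i j
    · obtain ⟨k, rfl⟩ := exists_of_familyMatrix_ne_zero hα
      have h1 : 1 ≤ ∑ i, Λ i (f i k) := by
        rw [sum_eq_card_div _ fun i => hval i (f i k), one_le_div hm']
        refine mod_cast (hcov k).trans (card_le_card fun i hi => ?_)
        simpa [S] using hfS i k (mem_filter.1 hi).2
      simp [matOf, h1]
    · rw [plexWeight_familyMatrix, hNW]
end
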